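/- If ℓ ≥ 2 and 2^ℓ·3 divides v_{2^ℓ·3}, then 2^ℓ divides v_{2^ℓ}. -/

import Mathlib

/-- Lucas sequence of the second kind: `v 0 = 2`, `v 1 = P`,
`v (n+2) = P * v (n+1) - Q * v n`. -/
def lucasV (P Q : ℤ) : ℕ → ℤ
  | 0 => 2
  | 1 => P
  | n + 2 => P * lucasV P Q (n + 1) - Q * lucasV P Q n

theorem lucasV_cast_eq_pow_add_pow {R : Type*} [CommRing R] {P Q : ℤ} {a b : R}
    (hP : a + b = P) (hQ : a * b = Q) (n : ℕ) : (lucasV P Q n : R) = a ^ n + b ^ n := by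
  induction n using Nat.twoStepInduction with
  | zero => norm_num [lucasV]
  | one => simp [lucasV, hP]
  | more n h₀ h₁ =>
    rw [lucasV]
    push_cast
    rw [h₀, h₁, ← hP, ← hQ]
    ring

theorem lucasV_mul_three (P Q : ℤ) (n : ℕ) :
    lucasV P Q (n * 3) = lucasV P Q n * (lucasV P Q n ^ 2 - 3 * Q ^ n) := by
  obtain ⟨d, hd⟩ := IsAlgClosed.exists_pow_nat_eq ((P : ℂ) ^ 2 - 4 * Q) two_pos
  have hP : (P + d) / 2 + (P - d) / 2 = (P : ℂ) := by ring
  have hQ : (P + d) / 2 * ((P - d) / 2) = (Q : ℂ) := by linear_combination -hd / 4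
  apply Int.cast_injective (α := ℂ)
  push_cast
  rw [lucasV_cast_eq_pow_add_pow hP hQ, lucasV_cast_eq_pow_add_pow hP hQ, ← hQ, mul_pow,
    pow_mul, pow_mul]
  ring

theorem odd_lucasV {P Q : ℤ} (hP : Odd P) (hQ : Even Q) (n : ℕ) : Odd (lucasV P Q (n + 1)) := by
  induction n with
  | zero => exact hP
  | succ n ih => exact (hP.mul ih).sub_even (hQ.mul_right _)

theorem two_pow_dvd_lucasV {P Q : ℤ} (hP : 2 ∣ P) (hQ : 2 ∣ Q) (m : ℕ) :
    2 ^ m ∣ lucasV P Q (2 * m) ∧ 2 ^ m ∣ lucasV P Q (2 * m + 1) := by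
  have step {n k : ℕ} (h₀ : 2 ^ k ∣ lucasV P Q n) (h₁ : 2 ^ k ∣ lucasV P Q (n + 1)) :
      2 ^ (k + 1) ∣ lucasV P Q (n + 2) := by
    rw [pow_succ']
    exact dvd_sub (mul_dvd_mul hP h₁) (mul_dvd_mul hQ h₀)
  induction m with
  | zero => simp
  | succ m ih =>
    have h := step ih.1 ih.2
    exact ⟨h, (pow_succ' (2 : ℤ) m) ▸
      dvd_sub (mul_dvd_mul hP ((pow_dvd_pow 2 m.le_succ).trans h)) (mul_dvd_mul hQ ih.2)⟩

/-- If `ℓ ≥ 2` and `2^ℓ·3 ∈ T`, then `2^ℓ ∈ T`. -/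
theorem two_pow_mem_T (P Q : ℤ) (ℓ : ℕ) (hℓ : 2 ≤ ℓ)
    (h : ((2 ^ ℓ * 3 : ℕ) : ℤ) ∣ lucasV P Q (2 ^ ℓ * 3)) :
    ((2 ^ ℓ : ℕ) : ℤ) ∣ lucasV P Q (2 ^ ℓ) := by
  push_cast at h ⊢
  have h_dvd := (Dvd.intro _ rfl).trans h
  have four_dvd : (4 : ℤ) ∣ lucasV P Q (2 ^ ℓ * 3) := (pow_dvd_pow 2 hℓ).trans h_dvd
  have even_v : Even (lucasV P Q (2 ^ ℓ * 3)) :=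
    even_iff_two_dvd.mpr ((by norm_num : (2 : ℤ) ∣ 4).trans four_dvd)
  rw [lucasV_mul_three] at h_dvd four_dvd
  rcases Int.even_or_odd Q with hQ | hQ
  · have hP : Even P := by
      by_contra hP
      have hodd := odd_lucasV (Int.not_even_iff_odd.mp hP) hQ (2 ^ ℓ * 3 - 1)
      rw [Nat.sub_add_cancel (Nat.succ_le_of_lt (by positivity))] at hodd
      exact Int.not_even_iff_odd.mpr hodd even_v
    obtain ⟨k, rfl⟩ : ∃ k, ℓ = k + 1 := ⟨ℓ - 1, by omega⟩
    have hdvd := (two_pow_dvd_lucasV hP.two_dvd hQ.two_dvd (2 ^ k)).1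
    rw [← pow_succ'] at hdvd
    exact (pow_dvd_pow 2 (Nat.succ_le_of_lt Nat.lt_two_pow_self)).trans hdvd
  · obtain ⟨c, hc⟩ : ∃ c, Q ^ 2 ^ ℓ = 4 * c + 1 := by
      obtain ⟨k, rfl⟩ : ∃ k, ℓ = k + 1 := ⟨ℓ - 1, by omega⟩
      obtain ⟨t, ht⟩ := hQ.pow (n := 2 ^ k)
      exact ⟨t ^ 2 + t, by rw [pow_succ 2 k, pow_mul, ht]; ring⟩
    rw [hc] at h_dvd four_dvd
    generalize lucasV P Q (2 ^ ℓ) = x at h_dvd four_dvd ⊢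
    rcases Int.even_or_odd' x with ⟨t, rfl | rfl⟩
    · refine IsCoprime.dvd_of_dvd_mul_right (IsCoprime.pow_left ?_) h_dvd
      exact ⟨2 * (1 + 3 * c - t ^ 2), 1, by ring⟩
    · obtain ⟨s, hs⟩ := four_dvd
      ring_nf at hs
      omega
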